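/- For every a ∈ M \ M₁ and every integer k ≥ 1, dpt(aθ^k) = dpt(a) + k. -/

import Mathlib

namespace GarsideOrder

variable {G : Type*} [Group G]

/-- `a ≤_R b` iff `b * a⁻¹ ∈ M`. -/
def leR (M : Submonoid G) (a b : G) : Prop := b * a⁻¹ ∈ M

/-- `a ≤_L b` iff `a⁻¹ * b ∈ M`. -/
def leL (M : Submonoid G) (a b : G) : Prop := a⁻¹ * b ∈ M

/-- Right divisors (in `M`) of `a`. -/
def DivR (M : Submonoid G) (a : G) : Set G := {b : G | b ∈ M ∧ leR M b a}

/-- Left divisors (in `M`) of `a`. -/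
def DivL (M : Submonoid G) (a : G) : Set G := {b : G | b ∈ M ∧ leL M b a}

/-- `a` is balanced if its sets of right and left divisors coincide. -/
def Balanced (M : Submonoid G) (a : G) : Prop := DivR M a = DivL M a

open Classical in
/-- The `N`-tail of `a`: the unique `b ∈ N` having the same right divisors lying in `N`
as `a` (w.r.t. the divisibility of the ambient monoid `M`). -/
noncomputable def tail (M N : Submonoid G) (a : G) : G :=
  if h : ∃ b : G, b ∈ N ∧
      {c : G | c ∈ N ∧ leR M c a} = {c : G | c ∈ N ∧ leR M c b} then
    h.choose
  else 1

/-- Iterated stripping of alternating tails: first the `M₁`-tail, then the `N`-tail, etc. -/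
noncomputable def strip (M M₁ N : Submonoid G) : ℕ → G → G
  | 0, a => a
  | i + 1, a =>
      strip M M₁ N i a *
        (tail M (if i % 2 = 0 then M₁ else N) (strip M M₁ N i a))⁻¹

/-- The breadth of `a`: the length of the alternating form of `a`, i.e. the least `p ≥ 1`
such that stripping alternating tails `p` times reaches `1`. -/
noncomputable def bh (M M₁ N : Submonoid G) (a : G) : ℕ :=
  sInf {p : ℕ | 1 ≤ p ∧ strip M M₁ N p a = 1}

/-- The depth of `a`: `(bh a - 1)/2` if `bh a` is odd, `bh a / 2` if `bh a` is even;
in both cases this is `bh a / 2` with natural division. -/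
noncomputable def dpt (M M₁ N : Submonoid G) (a : G) : ℕ := bh M M₁ N a / 2

/-- `a ∈ M` is unmovable if `Δ` does not right-divide it. -/
def Unmovable (M : Submonoid G) (Δ a : G) : Prop := a ∈ M ∧ ¬ leR M Δ a

/-- `α` is `(H, G₁)`-negative: its `Δ`-form is `a Δ^{-k}` with `k ≥ 1` and
`dpt a < dpt (Δ^k)`. -/
def Negative (M M₁ N : Submonoid G) (Δ : G) (α : G) : Prop :=
  ∃ a : G, ∃ k : ℕ, Unmovable M Δ a ∧ 1 ≤ k ∧ α = a * (Δ ^ k)⁻¹ ∧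
    dpt M M₁ N a < dpt M M₁ N (Δ ^ k)

/-- `α` is `(H, G₁)`-positive if `α⁻¹` is `(H, G₁)`-negative. -/
def Positive (M M₁ N : Submonoid G) (Δ : G) (α : G) : Prop :=
  Negative M M₁ N Δ α⁻¹

/-- The set `Θ` of theta elements `θ^k a₀`, `k ≥ 1`, `a₀ ∈ M₁`. -/
def thetaSet (M₁ : Submonoid G) (θ : G) : Set G :=
  {x : G | ∃ k : ℕ, 1 ≤ k ∧ ∃ a₀ ∈ M₁, x = θ ^ k * a₀}

/-- `Θ̄ = Θ ∪ M₁`. -/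
def thetaBar (M₁ : Submonoid G) (θ : G) : Set G := thetaSet M₁ θ ∪ (M₁ : Set G)

/-- Condition A with constant `ζ`: `dpt (Δ^k) = ζ k + 1` for all `k ≥ 1`. -/
def CondA (M M₁ N : Submonoid G) (Δ : G) (ζ : ℕ) : Prop :=
  ∀ k : ℕ, 1 ≤ k → dpt M M₁ N (Δ ^ k) = ζ * k + 1

/-- Condition B with constant `ζ`. -/
def CondB (M M₁ N : Submonoid G) (Δ θ : G) (ζ : ℕ) : Prop :=
  ∀ a b c : G, ∀ t : ℤ,
    Unmovable M Δ a → Unmovable M Δ b →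
    ¬(a ∈ thetaBar M₁ θ ∧ b ∈ thetaBar M₁ θ) →
    Unmovable M Δ c → a * b = c * Δ ^ t →
    ∃ ε : ℕ, ε ≤ 1 ∧
      (dpt M M₁ N c : ℤ) =
        (dpt M M₁ N a : ℤ) + (dpt M M₁ N b : ℤ) - (ζ : ℤ) * t - (ε : ℤ) ∧
      ((a ∈ thetaSet M₁ θ ∨ b ∈ thetaSet M₁ θ ∨ c ∈ M₁) → ε = 1)

/-- A Garside structure with group of fractions the subgroup `car`. -/
structure IsGarsideOn (car : Subgroup G) (M : Submonoid G) (Δ : G) : Prop where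
  M_sub : (M : Set G) ⊆ (car : Set G)
  delta_mem : Δ ∈ M
  units_trivial : ∀ x : G, x ∈ M → x⁻¹ ∈ M → x = 1
  noetherian : ∀ a ∈ M, ∃ n : ℕ, 1 ≤ n ∧ ∀ l : List G,
      (∀ x ∈ l, x ∈ M ∧ x ≠ 1) → l.prod = a → l.length ≤ n
  balanced : Balanced M Δ
  div_finite : (DivR M Δ).Finite
  div_gen_monoid : Submonoid.closure (DivR M Δ) = M
  div_gen_group : Subgroup.closure (DivR M Δ) = car
  meet : ∀ a ∈ car, ∀ b ∈ car, ∃ c ∈ car, leR M c a ∧ leR M c b ∧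
      ∀ d ∈ car, leR M d a → leR M d b → leR M d c
  join : ∀ a ∈ car, ∀ b ∈ car, ∃ c ∈ car, leR M a c ∧ leR M b c ∧
      ∀ d ∈ car, leR M a d → leR M b d → leR M c d

/-- The parabolic submonoid determined by `δ`: the submonoid generated by `Div(δ)`. -/
def parM (M : Submonoid G) (δ : G) : Submonoid G := Submonoid.closure (DivR M δ)

/-- The parabolic subgroup determined by `δ`: the subgroup generated by `Div(δ)`. -/
def parG (M : Submonoid G) (δ : G) : Subgroup G := Subgroup.closure (DivR M δ)

/-- `δ` determines a parabolic substructure of `(G, M, Δ)`. -/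
structure IsParabolic (M : Submonoid G) (Δ δ : G) : Prop where
  mem : δ ∈ M
  balanced : Balanced M δ
  div_eq : DivR M δ = DivR M Δ ∩ (parM M δ : Set G)

/-- The setting of Section 3: a Garside structure `(car, M, Δ)` together with two
parabolic substructures `(H, N, Λ)` (given by `lam`) and `(G₁, M₁, Δ₁)` (given by `δ1`),
with `N ≠ M`, `M₁ ≠ M`, `N ∪ M₁` generating `M`, `Δ` central, `Δ₁` central in `G₁`. -/
structure Setting (G : Type*) [Group G] where
  car : Subgroup G
  M : Submonoid G
  Δ : G
  δ1 : G
  lam : G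
  garside : IsGarsideOn car M Δ
  par1 : IsParabolic M Δ δ1
  parH : IsParabolic M Δ lam
  N_ne : parM M lam ≠ M
  M1_ne : parM M δ1 ≠ M
  unionGen : Submonoid.closure ((parM M lam : Set G) ∪ (parM M δ1 : Set G)) = M
  delta_central : ∀ g ∈ car, Δ * g = g * Δ
  delta1_central : ∀ g ∈ parG M δ1, δ1 * g = g * δ1

namespace Setting

variable (S : Setting G)

/-- The parabolic submonoid `M₁`. -/
def M₁ : Submonoid G := parM S.M S.δ1

/-- The parabolic submonoid `N`. -/
def Nsub : Submonoid G := parM S.M S.lam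

/-- The parabolic subgroup `G₁`. -/
def G₁ : Subgroup G := parG S.M S.δ1

/-- `θ = Δ Δ₁⁻¹`. -/
def theta : G := S.Δ * S.δ1⁻¹

/-- The set of `(H, G₁)`-negative elements. -/
def Neg : Set G := {α : G | Negative S.M S.M₁ S.Nsub S.Δ α}

/-- The set of `(H, G₁)`-positive elements. -/
def Pos : Set G := {α : G | α⁻¹ ∈ S.Neg}

/-- Condition A. -/
def condA (ζ : ℕ) : Prop := CondA S.M S.M₁ S.Nsub S.Δ ζ

/-- Condition B. -/
def condB (ζ : ℕ) : Prop := CondB S.M S.M₁ S.Nsub S.Δ S.theta ζ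

/-- `(H, G₁)` is a Dehornoy structure: `PP ⊆ P`, `G₁ P G₁ ⊆ P`, and the group is the
disjoint union of `P`, `P⁻¹` and `G₁`. -/
def IsDehornoy : Prop :=
  (∀ α ∈ S.Pos, ∀ β ∈ S.Pos, α * β ∈ S.Pos) ∧
  (∀ g₁ ∈ S.G₁, ∀ α ∈ S.Pos, ∀ g₂ ∈ S.G₁, g₁ * α * g₂ ∈ S.Pos) ∧
  (∀ α ∈ S.car, α ∈ S.Pos ∨ α ∈ S.Neg ∨ α ∈ S.G₁) ∧
  (∀ α : G, ¬(α ∈ S.Pos ∧ α ∈ S.Neg)) ∧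
  (∀ α : G, ¬(α ∈ S.Pos ∧ α ∈ S.G₁)) ∧
  (∀ α : G, ¬(α ∈ S.Neg ∧ α ∈ S.G₁))

end Setting

end GarsideOrder


namespace BraidOrder

open GarsideOrder

/-- The braid relations on `n` generators `σ_0, …, σ_{n-1}` (representing `s_1, …, s_n`). -/
def braidRel (n : ℕ) : Set (FreeGroup (Fin n)) :=
  {r | ∃ i j : Fin n,
      ((i : ℕ) + 1 = (j : ℕ) ∧
        r = FreeGroup.of i * FreeGroup.of j * FreeGroup.of i *
            (FreeGroup.of j * FreeGroup.of i * FreeGroup.of j)⁻¹) ∨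
      ((i : ℕ) + 2 ≤ (j : ℕ) ∧
        r = FreeGroup.of i * FreeGroup.of j * (FreeGroup.of j * FreeGroup.of i)⁻¹)}

/-- The braid group `B_{n+1}` on `n+1` strands, presented with `n` generators. -/
abbrev Braid (n : ℕ) := PresentedGroup (braidRel n)

/-- `gen n i` is the generator `s_{i+1}` of `B_{n+1}` (for `i < n`). -/
def gen (n i : ℕ) : Braid n :=
  if h : i < n then PresentedGroup.of ⟨i, h⟩ else 1

/-- The product `gen a * gen (a+1) * ⋯ * gen (b-1)`, i.e. `s_{a+1} s_{a+2} ⋯ s_b`. -/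
def seg (n a b : ℕ) : Braid n := (((List.range b).drop a).map (gen n)).prod

/-- The product `gen (b-1) * ⋯ * gen (a+1) * gen a`, i.e. `s_b ⋯ s_{a+2} s_{a+1}`. -/
def segRev (n a b : ℕ) : Braid n := ((((List.range b).drop a).reverse).map (gen n)).prod

/-- The positive braid monoid `B_{n+1}^+`. -/
def Mb (n : ℕ) : Submonoid (Braid n) :=
  Submonoid.closure {x : Braid n | ∃ i : ℕ, i < n ∧ x = gen n i}

/-- The submonoid generated by `s_2, …, s_n`. -/
def M₁b (n : ℕ) : Submonoid (Braid n) :=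
  Submonoid.closure {x : Braid n | ∃ i : ℕ, 1 ≤ i ∧ i < n ∧ x = gen n i}

/-- The submonoid generated by `s_1, …, s_{n-1}`. -/
def Nb (n : ℕ) : Submonoid (Braid n) :=
  Submonoid.closure {x : Braid n | ∃ i : ℕ, i + 1 < n ∧ x = gen n i}

/-- The subgroup generated by `s_2, …, s_n`. -/
def G₁b (n : ℕ) : Subgroup (Braid n) :=
  Subgroup.closure {x : Braid n | ∃ i : ℕ, 1 ≤ i ∧ i < n ∧ x = gen n i}

/-- The subgroup generated by `s_1, …, s_{n-1}`. -/
def Hb (n : ℕ) : Subgroup (Braid n) :=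
  Subgroup.closure {x : Braid n | ∃ i : ℕ, i + 1 < n ∧ x = gen n i}

/-- The Garside element `Δ = (s_1 s_2 ⋯ s_n)^{n+1}`. -/
def Δb (n : ℕ) : Braid n := seg n 0 n ^ (n + 1)

/-- `Δ₁ = (s_2 ⋯ s_n)^n`. -/
def Δ₁b (n : ℕ) : Braid n := seg n 1 n ^ n

/-- `Λ = (s_1 ⋯ s_{n-1})^n`. -/
def Λb (n : ℕ) : Braid n := seg n 0 (n - 1) ^ n

/-- `θ = s_1 ⋯ s_{n-1} s_n² s_{n-1} ⋯ s_1` as an explicit word. -/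
def thetaWordb (n : ℕ) : Braid n := seg n 0 n * segRev n 0 n

/-! ### Sequences satisfying the braid relations -/

section BraidLike

variable {K : Type*} [Monoid K]

/-- The first `n` terms of the sequence `g` satisfy the braid relations. -/
structure BraidLike (n : ℕ) (g : ℕ → K) : Prop where
  braid : ∀ i, i + 1 < n → g i * g (i + 1) * g i = g (i + 1) * g i * g (i + 1)
  comm : ∀ i j, i + 2 ≤ j → j < n → Commute (g i) (g j)

/-- The product `g 0 * ⋯ * g (m - 1)`. -/
def up (g : ℕ → K) (m : ℕ) : K := ((List.range m).map g).prod

/-- The product `g (m - 1) * ⋯ * g 0`. -/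
def down (g : ℕ → K) (m : ℕ) : K := ((List.range m).reverse.map g).prod

theorem up_succ (g : ℕ → K) (m : ℕ) : up g (m + 1) = up g m * g m := by
  simp [up, List.range_succ]

theorem up_succ' (g : ℕ → K) (m : ℕ) : up g (m + 1) = g 0 * up (fun i => g (i + 1)) m := by
  simp [up, List.range_succ_eq_map, Function.comp_def]

theorem down_succ (g : ℕ → K) (m : ℕ) : down g (m + 1) = g m * down g m := by
  simp [down, List.range_succ]

theorem commute_list_prod {g : ℕ → K} {c : K} {l : List ℕ} (h : ∀ i ∈ l, Commute c (g i)) :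
    Commute c (l.map g).prod := by
  induction l with
  | nil => simp
  | cons i l ih =>
    rw [List.map_cons, List.prod_cons]
    exact (h i (by simp)).mul_right (ih fun k hk => h k (by simp [hk]))

variable {n : ℕ} {g : ℕ → K}

namespace BraidLike

theorem commute_up (hg : BraidLike n g) {i : ℕ} (hi : i + 1 < n) :
    Commute (g (i + 1)) (up g i) :=
  commute_list_prod fun k hk => (hg.comm k (i + 1) (by simp at hk; omega) hi).symm

theorem commute_down (hg : BraidLike n g) {i : ℕ} (hi : i + 1 < n) :
    Commute (g (i + 1)) (down g i) :=
  commute_list_prod fun k hk => (hg.comm k (i + 1) (by simp at hk; omega) hi).symm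

theorem up_mul (hg : BraidLike n g) {m i : ℕ} (hi : i + 1 < m) (hm : m ≤ n) :
    up g m * g i = g (i + 1) * up g m := by
  induction m with
  | zero => omega
  | succ m ih =>
    rcases Nat.lt_or_ge (i + 1) m with h | h
    · rw [up_succ, mul_assoc, ← (hg.comm i m h hm).eq, ← mul_assoc, ih h (by omega), mul_assoc]
    · obtain rfl : m = i + 1 := by omega
      rw [up_succ, up_succ]
      calc up g i * g i * g (i + 1) * g i
          = up g i * (g i * g (i + 1) * g i) := by simp only [mul_assoc]
        _ = up g i * g (i + 1) * (g i * g (i + 1)) := by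
            rw [hg.braid i hm]; simp only [mul_assoc]
        _ = g (i + 1) * (up g i * g i * g (i + 1)) := by
            rw [← (hg.commute_up hm).eq]; simp only [mul_assoc]

theorem down_mul (hg : BraidLike n g) {m i : ℕ} (hi : i + 1 < m) (hm : m ≤ n) :
    down g m * g (i + 1) = g i * down g m := by
  induction m with
  | zero => omega
  | succ m ih =>
    rcases Nat.lt_or_ge (i + 1) m with h | h
    · rw [down_succ, mul_assoc, ih h (by omega), ← mul_assoc, ← (hg.comm i m h hm).eq, mul_assoc]
    · obtain rfl : m = i + 1 := by omega
      rw [down_succ, down_succ]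
      calc g (i + 1) * (g i * down g i) * g (i + 1)
          = g (i + 1) * g i * (down g i * g (i + 1)) := by simp only [mul_assoc]
        _ = (g (i + 1) * g i * g (i + 1)) * down g i := by
            rw [← (hg.commute_down hm).eq]; simp only [mul_assoc]
        _ = g i * (g (i + 1) * (g i * down g i)) := by
            rw [← hg.braid i hm]; simp only [mul_assoc]

theorem up_pow_mul (hg : BraidLike n g) (k : ℕ) {i : ℕ} (hi : i + k < n) :
    up g n ^ k * g i = g (i + k) * up g n ^ k := by
  induction k with
  | zero => simp
  | succ k ih =>
    rw [pow_succ', mul_assoc, ih (by omega), ← mul_assoc, hg.up_mul (by omega) le_rfl, mul_assoc,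
      add_assoc]

theorem up_mul_up (hg : BraidLike n g) {m : ℕ} (hm : m < n) :
    up g n * up g m = up (fun i => g (i + 1)) m * up g n := by
  induction m with
  | zero => simp [up]
  | succ m ih =>
    rw [up_succ, up_succ, ← mul_assoc, ih (by omega), mul_assoc, hg.up_mul hm le_rfl, mul_assoc]

theorem up_sq_mul {m : ℕ} (hg : BraidLike (m + 1) g) :
    up g (m + 1) ^ 2 * g m = g 0 * up g (m + 1) ^ 2 := by
  have h := hg.up_mul_up (m := m) (by omega)
  calc up g (m + 1) ^ 2 * g m
      = g 0 * (up (fun i => g (i + 1)) m * up g (m + 1)) * g m := by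
        rw [sq]; nth_rw 1 [up_succ']; simp only [mul_assoc]
    _ = g 0 * up g (m + 1) * (up g m * g m) := by rw [← h]; simp only [mul_assoc]
    _ = g 0 * up g (m + 1) ^ 2 := by rw [← up_succ, sq, mul_assoc]

/-- The full twist commutes with the generators. -/
theorem commute_up_pow (hg : BraidLike n g) {i : ℕ} (hi : i < n) :
    Commute (up g n ^ (n + 1)) (g i) := by
  obtain ⟨k, rfl⟩ : ∃ k, n = i + k + 1 := ⟨n - i - 1, by omega⟩
  have h1 := hg.up_pow_mul k (i := i) (by omega)
  have h2 := hg.up_pow_mul i (i := 0) (by omega)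
  rw [Nat.zero_add] at h2
  have h3 := hg.up_sq_mul
  have e : up g (i + k + 1) ^ (i + k + 1 + 1) =
      up g (i + k + 1) ^ i * up g (i + k + 1) ^ 2 * up g (i + k + 1) ^ k := by
    rw [← pow_add, ← pow_add]; congr 1; omega
  have e' : up g (i + k + 1) ^ (i + k + 1 + 1) =
      up g (i + k + 1) ^ i * (up g (i + k + 1) ^ 2 * up g (i + k + 1) ^ k) := by
    rw [e, mul_assoc]
  change _ = _
  calc up g (i + k + 1) ^ (i + k + 1 + 1) * g i
      = up g (i + k + 1) ^ i * (up g (i + k + 1) ^ 2 * g (i + k)) * up g (i + k + 1) ^ k := by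
        rw [e, mul_assoc, h1]; simp only [mul_assoc]
    _ = (up g (i + k + 1) ^ i * g 0) * up g (i + k + 1) ^ 2 * up g (i + k + 1) ^ k := by
        rw [h3]; simp only [mul_assoc]
    _ = g i * up g (i + k + 1) ^ (i + k + 1 + 1) := by
        rw [h2, e]; simp only [mul_assoc]

/-- The generators right-divide the full twist. -/
theorem exists_mul_eq_up_pow (hg : BraidLike n g) {i : ℕ} (hi : i < n) :
    ∃ u, u * g i = up g n ^ (n + 1) := by
  obtain ⟨k, rfl⟩ : ∃ k, n = i + k + 1 := ⟨n - i - 1, by omega⟩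
  refine ⟨up g (i + k + 1) ^ (i + 1) * up g (i + k) * up g (i + k + 1) ^ k, ?_⟩
  rw [mul_assoc, hg.up_pow_mul k (by omega), mul_assoc, ← mul_assoc (up g (i + k)), ← up_succ,
    ← pow_succ', ← pow_add]
  congr 1
  omega

theorem commute_up_mul_down (hg : BraidLike n g) {i : ℕ} (hi : 1 ≤ i) (hin : i < n) :
    Commute (up g n * down g n) (g i) := by
  obtain ⟨k, rfl⟩ : ∃ k, i = k + 1 := ⟨i - 1, by omega⟩
  change _ = _
  rw [mul_assoc, hg.down_mul hin le_rfl, ← mul_assoc, hg.up_mul hin le_rfl, mul_assoc]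

end BraidLike

end BraidLike

/-! ### The positive braid monoid -/

/-- The braid relations, read as relations between positive words. -/
inductive posRel (n : ℕ) : FreeMonoid (Fin n) → FreeMonoid (Fin n) → Prop
  | braid (i j : Fin n) (h : (i : ℕ) + 1 = j) :
      posRel n (.of i * .of j * .of i) (.of j * .of i * .of j)
  | comm (i j : Fin n) (h : (i : ℕ) + 2 ≤ j) : posRel n (.of i * .of j) (.of j * .of i)

/-- The monoid presented by the braid relations. -/
abbrev PosBraid (n : ℕ) := PresentedMonoid (posRel n)

namespace PosBraid

variable {n : ℕ}

/-- The generators of the positive braid monoid. -/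
def s (i : Fin n) : PosBraid n := PresentedMonoid.of (posRel n) i

/-- Two indices of commuting distinct generators. -/
def Far (i j : Fin n) : Prop := (i : ℕ) + 2 ≤ j ∨ (j : ℕ) + 2 ≤ i

/-- Two indices of adjacent generators. -/
def Adj (i j : Fin n) : Prop := (i : ℕ) + 1 = j ∨ (j : ℕ) + 1 = i

theorem Far.symm {i j : Fin n} (h : Far i j) : Far j i := Or.symm h

theorem Adj.symm {i j : Fin n} (h : Adj i j) : Adj j i := Or.symm h

theorem eq_or_far_or_adj (i j : Fin n) : i = j ∨ Far i j ∨ Adj i j := by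
  unfold Far Adj
  rw [Fin.ext_iff]
  omega

theorem s_comm {i j : Fin n} (h : Far i j) : s i * s j = s j * s i := by
  rcases h with h | h
  · exact PresentedMonoid.mk_eq_mk_of_rel (.comm i j h)
  · exact (PresentedMonoid.mk_eq_mk_of_rel (.comm j i h)).symm

theorem s_braid {i j : Fin n} (h : Adj i j) : s i * s j * s i = s j * s i * s j := by
  rcases h with h | h
  · exact PresentedMonoid.mk_eq_mk_of_rel (.braid i j h)
  · exact (PresentedMonoid.mk_eq_mk_of_rel (.braid j i h)).symm

theorem s_comm_assoc {i j : Fin n} (h : Far i j) (x : PosBraid n) :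
    x * s i * s j = x * s j * s i := by
  rw [mul_assoc, s_comm h, mul_assoc]

theorem s_braid_assoc {i j : Fin n} (h : Adj i j) (x : PosBraid n) :
    x * s i * s j * s i = x * s j * s i * s j := by
  have := congrArg (x * ·) (s_braid h)
  simpa only [mul_assoc] using this

/-- The word length, as a monoid homomorphism. -/
def lenHom (n : ℕ) : PosBraid n →* Multiplicative ℕ :=
  PresentedMonoid.lift (fun _ => Multiplicative.ofAdd 1) (by
    intro a b h
    cases h <;> simp)

/-- The word length. -/
def len (x : PosBraid n) : ℕ := (lenHom n x).toAdd

@[simp] theorem len_mul (x y : PosBraid n) : len (x * y) = len x + len y := by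
  simp [len]

@[simp] theorem len_s (i : Fin n) : len (s i) = 1 := rfl

/-- The elements `x * s i` and `y * s j` agree for the obvious reason, namely that they are the
same multiple of the least common left multiple of `s i` and `s j`. -/
def Meets (x : PosBraid n) (i : Fin n) (y : PosBraid n) (j : Fin n) : Prop :=
  (i = j ∧ x = y) ∨ (Far i j ∧ ∃ z, x = z * s j ∧ y = z * s i) ∨
    (Adj i j ∧ ∃ z, x = z * s i * s j ∧ y = z * s j * s i)

theorem Meets.symm {x y : PosBraid n} {i j : Fin n} (h : Meets x i y j) : Meets y j x i := by
  rcases h with ⟨h, h'⟩ | ⟨h, z, h1, h2⟩ | ⟨h, z, h1, h2⟩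
  · exact .inl ⟨h.symm, h'.symm⟩
  · exact .inr (.inl ⟨h.symm, z, h2, h1⟩)
  · exact .inr (.inr ⟨h.symm, z, h2, h1⟩)

theorem Meets.mul_left {x y : PosBraid n} {i j : Fin n} (h : Meets x i y j) (u : PosBraid n) :
    Meets (u * x) i (u * y) j := by
  rcases h with ⟨h, rfl⟩ | ⟨h, z, rfl, rfl⟩ | ⟨h, z, rfl, rfl⟩
  · exact .inl ⟨h, rfl⟩
  · exact .inr (.inl ⟨h, u * z, by simp only [mul_assoc], by simp only [mul_assoc]⟩)
  · exact .inr (.inr ⟨h, u * z, by simp only [mul_assoc], by simp only [mul_assoc]⟩)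

/-- The Garside lemma for elements of length less than `L`. -/
def MeetsBelow (n L : ℕ) : Prop :=
  ∀ (x y : PosBraid n) (i j : Fin n), len x < L → x * s i = y * s j → Meets x i y j

theorem MeetsBelow.cancel {L : ℕ} (H : MeetsBelow n L) {x y : PosBraid n} {i : Fin n}
    (hx : len x < L) (h : x * s i = y * s i) : x = y := by
  rcases H x y i i hx h with h | ⟨h, -⟩ | ⟨h, -⟩
  · exact h.2
  · unfold Far at h; omega
  · unfold Adj at h; omega

theorem MeetsBelow.far {L : ℕ} (H : MeetsBelow n L) {x y : PosBraid n} {i j : Fin n}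
    (hx : len x < L) (hij : Far i j) (h : x * s i = y * s j) :
    ∃ z, x = z * s j ∧ y = z * s i := by
  rcases H x y i j hx h with ⟨rfl, -⟩ | h | ⟨h, -⟩
  · unfold Far at hij; omega
  · exact h.2
  · unfold Far at hij; unfold Adj at h; omega

theorem MeetsBelow.adj {L : ℕ} (H : MeetsBelow n L) {x y : PosBraid n} {i j : Fin n}
    (hx : len x < L) (hij : Adj i j) (h : x * s i = y * s j) :
    ∃ z, x = z * s i * s j ∧ y = z * s j * s i := by
  rcases H x y i j hx h with ⟨rfl, -⟩ | ⟨h, -⟩ | h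
  · unfold Adj at hij; omega
  · unfold Adj at hij; unfold Far at h; omega
  · exact h.2

theorem meets_of_far_adj {L : ℕ} (H : MeetsBelow n L) {z z' : PosBraid n} {i k j : Fin n}
    (hz : len z < L) (hik : Far i k) (hkj : Adj k j) (h : z * s i = z' * s k * s j) :
    Meets (z * s k) i (z' * s j * s k) j := by
  have hlen := congrArg len h
  simp only [len_mul, len_s] at hlen
  rcases eq_or_far_or_adj i j with rfl | hij | hij
  · unfold Far at hik; unfold Adj at hkj; omega
  · obtain ⟨u, rfl, hu⟩ := H.far hz hij h
    obtain ⟨v, rfl, rfl⟩ := H.far (by omega) hik.symm hu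
    refine .inr (.inl ⟨hij, v * s j * s k, ?_, ?_⟩)
    · rw [s_braid_assoc hkj]
    · rw [s_comm_assoc hij, s_comm_assoc hik]
  · obtain ⟨u, rfl, hu⟩ := H.adj hz hij h
    simp only [len_mul, len_s] at hlen hz
    obtain ⟨v, rfl, hv⟩ := H.far (by omega) hik.symm hu
    simp only [len_mul, len_s] at hlen hz
    obtain ⟨t, rfl, rfl⟩ := H.adj (by omega) hkj.symm hv
    refine .inr (.inr ⟨hij, t * s i * s j * s k, ?_, ?_⟩)
    · rw [s_comm_assoc hik.symm (t * s j), s_braid_assoc hkj, ← s_braid_assoc hij,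
        s_comm_assoc hik]
    · rw [← s_braid_assoc hij, s_comm_assoc hik.symm t, s_comm_assoc hik, s_braid_assoc hkj]

theorem meets_of_adj_adj {L : ℕ} (H : MeetsBelow n L) {z z' : PosBraid n} {i k j : Fin n}
    (hz : len z + 1 < L) (hik : Adj i k) (hkj : Adj k j) (h : z * s k * s i = z' * s k * s j) :
    Meets (z * s i * s k) i (z' * s j * s k) j := by
  have hlen := congrArg len h
  simp only [len_mul, len_s] at hlen
  rcases eq_or_far_or_adj i j with rfl | hij | hij
  · have := H.cancel (by simpa using hz) h
    have := H.cancel (by omega) this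
    subst this
    exact .inl ⟨rfl, rfl⟩
  · obtain ⟨v, hv, hv'⟩ := H.far (by simpa using hz) hij h
    obtain ⟨p, rfl, rfl⟩ := H.adj (by omega) hkj hv
    obtain ⟨q, rfl, hq⟩ := H.adj (by omega) hik.symm hv'
    simp only [len_mul, len_s] at hlen hz
    have hpq := H.cancel (by simp; omega) hq
    obtain ⟨r, rfl, rfl⟩ := H.far (by omega) hij.symm hpq
    refine .inr (.inl ⟨hij, r * s k * s i * s j * s k, ?_, ?_⟩)
    · rw [s_comm_assoc hij.symm, s_braid_assoc hik, s_braid_assoc hkj]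
    · rw [s_comm_assoc hij, s_braid_assoc hkj.symm, s_braid_assoc hik.symm,
        s_comm_assoc hij.symm (r * s k)]
  · unfold Adj at hik hkj hij; omega

theorem Meets.trans {L : ℕ} (H : MeetsBelow n L) {x w y : PosBraid n} {i k j : Fin n}
    (hx : len x ≤ L) (h : Meets x i w k) (h' : Meets w k y j) : Meets x i y j := by
  rcases h with ⟨rfl, rfl⟩ | ⟨hik, z, rfl, rfl⟩ | ⟨hik, z, rfl, rfl⟩
  · exact h'
  · simp only [len_mul, len_s] at hx
    rcases h' with ⟨rfl, rfl⟩ | ⟨hkj, z', h, rfl⟩ | ⟨hkj, z', h, rfl⟩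
    · exact .inr (.inl ⟨hik, z, rfl, rfl⟩)
    · rcases eq_or_far_or_adj i j with rfl | hij | hij
      · have := H.cancel (by omega) h
        subst this
        exact .inl ⟨rfl, rfl⟩
      · obtain ⟨u, rfl, rfl⟩ := H.far (by omega) hij h
        refine .inr (.inl ⟨hij, u * s k, ?_, ?_⟩)
        · rw [s_comm_assoc hkj]
        · rw [s_comm_assoc hik]
      · obtain ⟨u, rfl, rfl⟩ := H.adj (by omega) hij h
        refine .inr (.inr ⟨hij, u * s k, ?_, ?_⟩)
        · rw [s_comm_assoc hkj.symm, s_comm_assoc hik]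
        · rw [s_comm_assoc hik, s_comm_assoc hkj.symm]
    · exact meets_of_far_adj H (by omega) hik hkj h
  · simp only [len_mul, len_s] at hx
    rcases h' with ⟨rfl, rfl⟩ | ⟨hkj, z', h, rfl⟩ | ⟨hkj, z', h, rfl⟩
    · exact .inr (.inr ⟨hik, z, rfl, rfl⟩)
    · have hlen := congrArg len h
      simp only [len_mul, len_s] at hlen
      exact (meets_of_far_adj H (by omega) hkj.symm hik.symm h.symm).symm
    · exact meets_of_adj_adj H (by omega) hik hkj h

theorem len_mk (u : FreeMonoid (Fin n)) : len (PresentedMonoid.mk (posRel n) u) = u.length := by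
  induction u using FreeMonoid.inductionOn with
  | one => rfl
  | of i => rfl
  | mul u v hu hv => rw [map_mul, len_mul, hu, hv, FreeMonoid.length_mul]

theorem eq_one_or_eq_mul_of {α : Type*} (u : FreeMonoid α) :
    u = 1 ∨ ∃ X i, u = X * FreeMonoid.of i := by
  rcases List.eq_nil_or_concat u.toList with h | ⟨X, i, h⟩
  · exact .inl h
  · rw [List.concat_eq_append] at h
    exact .inr ⟨FreeMonoid.ofList X, i, h⟩

theorem mul_of_inj {α : Type*} {X Y : FreeMonoid α} {i j : α}
    (h : X * FreeMonoid.of i = Y * FreeMonoid.of j) : X = Y ∧ i = j := by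
  have hXY : X.toList ++ [i] = Y.toList ++ [j] := h
  rw [← List.concat_eq_append, ← List.concat_eq_append, List.concat_inj] at hXY
  exact hXY

/-- Equivalent positive words that end in `i` and in `j` meet in the sense of `Meets`. -/
theorem meets_of_conGen {L : ℕ} (H : MeetsBelow n L) {u v : FreeMonoid (Fin n)}
    (h : ConGen.Rel (posRel n) u v) : u.length ≤ L + 1 →
      ∀ X i Y j, u = X * FreeMonoid.of i → v = Y * FreeMonoid.of j →
        Meets (PresentedMonoid.mk _ X) i (PresentedMonoid.mk _ Y) j := by
  have hl : ∀ {u v : FreeMonoid (Fin n)}, ConGen.Rel (posRel n) u v → u.length = v.length := by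
    intro u v h
    rw [← len_mk, ← len_mk, PresentedMonoid.mk_eq_mk_iff.2 h]
  induction h with
  | of u v h =>
    intro _ X i Y j hu hv
    cases h with
    | braid a b h =>
      obtain ⟨rfl, rfl⟩ := mul_of_inj hu
      obtain ⟨rfl, rfl⟩ := mul_of_inj hv
      exact .inr (.inr ⟨.inl h, 1, by simp [s, PresentedMonoid.of],
        by simp [s, PresentedMonoid.of]⟩)
    | comm a b h =>
      obtain ⟨rfl, rfl⟩ := mul_of_inj hu
      obtain ⟨rfl, rfl⟩ := mul_of_inj hv
      exact .inr (.inl ⟨.inr h, 1, by simp [s, PresentedMonoid.of],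
        by simp [s, PresentedMonoid.of]⟩)
  | refl u =>
    rintro _ X i Y j rfl hv
    obtain ⟨rfl, rfl⟩ := mul_of_inj hv
    exact .inl ⟨rfl, rfl⟩
  | symm h ih =>
    intro hL X i Y j hu hv
    exact (ih (hl h ▸ hL) Y j X i hv hu).symm
  | @trans u w v h h' ih ih' =>
    intro hL X i Y j hu hv
    rcases eq_one_or_eq_mul_of w with rfl | ⟨W, k, rfl⟩
    · have := hl h
      simp [hu] at this
    · refine Meets.trans H ?_ (ih hL X i W k hu rfl) (ih' (hl h ▸ hL) W k Y j rfl hv)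
      rw [len_mk]
      simpa [hu] using hL
  | @mul u v u' v' h h' ih ih' =>
    intro hL X i Y j hu hv
    rw [FreeMonoid.length_mul] at hL
    rcases eq_one_or_eq_mul_of u' with rfl | ⟨X', i', rfl⟩
    · have hv' : v' = 1 := FreeMonoid.length_eq_zero.1 (by rw [← hl h', FreeMonoid.length_one])
      subst hv'
      exact ih (by omega) X i Y j (by simpa using hu) (by simpa using hv)
    · rcases eq_one_or_eq_mul_of v' with rfl | ⟨Y', j', rfl⟩
      · have := hl h'
        simp at this
      · rw [← mul_assoc] at hu hv
        obtain ⟨rfl, rfl⟩ := mul_of_inj hu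
        obtain ⟨rfl, rfl⟩ := mul_of_inj hv
        have := (ih' (by omega) X' i' Y' j' rfl rfl).mul_left (PresentedMonoid.mk _ u)
        rw [map_mul, map_mul, ← PresentedMonoid.mk_eq_mk_iff.2 h]
        exact this

theorem meetsBelow (L : ℕ) : MeetsBelow n L := by
  induction L with
  | zero => intro x y i j h; omega
  | succ L ih =>
    intro x y i j hx h
    obtain ⟨X, rfl⟩ := PresentedMonoid.surjective_mk x
    obtain ⟨Y, rfl⟩ := PresentedMonoid.surjective_mk y
    refine meets_of_conGen ih (u := X * .of i) (v := Y * .of j) ?_ ?_ X i Y j rfl rfl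
    · exact PresentedMonoid.mk_eq_mk_iff.1 (by rw [map_mul, map_mul]; exact h)
    · rw [len_mk] at hx
      simp
      omega

/-- The Garside lemma. -/
theorem meets {x y : PosBraid n} {i j : Fin n} (h : x * s i = y * s j) : Meets x i y j :=
  meetsBelow (len x + 1) x y i j (by omega) h

@[elab_as_elim]
theorem induction_on {P : PosBraid n → Prop} (x : PosBraid n) (one : P 1) (gen : ∀ i, P (s i))
    (mul : ∀ x y, P x → P y → P (x * y)) : P x := by
  obtain ⟨u, rfl⟩ := PresentedMonoid.surjective_mk x
  induction u using FreeMonoid.inductionOn with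
  | one => exact one
  | of i => exact gen i
  | mul u v hu hv => rw [map_mul]; exact mul _ _ hu hv

theorem mul_right_cancel' {x y : PosBraid n} (c : PosBraid n) (h : x * c = y * c) : x = y := by
  induction c using induction_on generalizing x y with
  | one => simpa using h
  | gen i => exact (meetsBelow (len x + 1)).cancel (by omega) h
  | mul c d hc hd =>
    rw [← mul_assoc, ← mul_assoc] at h
    exact hc (hd h)

/-- Reversal of positive braids. -/
def rev (n : ℕ) : PosBraid n →* (PosBraid n)ᵐᵒᵖ :=
  PresentedMonoid.lift (fun i => .op (s i)) (by
    intro a b h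
    cases h with
    | braid i j h =>
      simpa [← MulOpposite.op_mul, ← mul_assoc] using s_braid (.inl h)
    | comm i j h =>
      simpa [← MulOpposite.op_mul] using s_comm (.inr h))

theorem rev_rev (x : PosBraid n) : (rev n (rev n x).unop).unop = x := by
  induction x using induction_on with
  | one => simp
  | gen i => rfl
  | mul x y hx hy => simp [hx, hy]

theorem mul_left_cancel' {x y : PosBraid n} (c : PosBraid n) (h : c * x = c * y) : x = y := by
  have h' := congrArg (fun t => (rev n t).unop) h
  simp only [map_mul, MulOpposite.unop_mul] at h'
  have := congrArg (fun t => (rev n t).unop) (mul_right_cancel' _ h')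
  simpa only [rev_rev] using this

/-- The generators, indexed by natural numbers and extended by `1`. -/
def sNat (n i : ℕ) : PosBraid n := if h : i < n then s ⟨i, h⟩ else 1

theorem sNat_val (i : Fin n) : sNat n i = s i := by simp [sNat]

theorem braidLike_sNat (n : ℕ) : BraidLike n (sNat n) where
  braid i hi := by
    have : i < n := by omega
    simpa [sNat, hi, this] using s_braid (.inl rfl)
  comm i j hij hj := by
    have : i < n := by omega
    simpa [sNat, hj, this, Commute, SemiconjBy] using s_comm (.inl hij)

theorem commute_up_pow (x : PosBraid n) : Commute (up (sNat n) n ^ (n + 1)) x := by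
  induction x using induction_on with
  | one => exact Commute.one_right _
  | gen i => rw [← sNat_val]; exact (braidLike_sNat n).commute_up_pow i.2
  | mul x y hx hy => exact hx.mul_right hy

theorem exists_mul_eq_up_pow (x : PosBraid n) :
    ∃ u k, u * x = (up (sNat n) n ^ (n + 1)) ^ k := by
  induction x using induction_on with
  | one => exact ⟨1, 0, by simp⟩
  | gen i =>
    obtain ⟨u, hu⟩ := (braidLike_sNat n).exists_mul_eq_up_pow i.2
    exact ⟨u, 1, by rw [← sNat_val, hu, pow_one]⟩
  | mul x y hx hy =>
    obtain ⟨u, k, hu⟩ := hx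
    obtain ⟨v, m, hv⟩ := hy
    refine ⟨v * u, m + k, ?_⟩
    rw [mul_assoc, ← mul_assoc u, hu, ((commute_up_pow y).pow_left k).eq, ← mul_assoc, hv,
      pow_add _ m k]

theorem exists_mul_eq_mul (x y : PosBraid n) : ∃ u v, u * x = v * y := by
  obtain ⟨u, k, hu⟩ := exists_mul_eq_up_pow x
  obtain ⟨v, m, hv⟩ := exists_mul_eq_up_pow y
  exact ⟨(up (sNat n) n ^ (n + 1)) ^ m * u, (up (sNat n) n ^ (n + 1)) ^ k * v, by
    rw [mul_assoc, hu, mul_assoc, hv, ← pow_add, ← pow_add, add_comm m k]⟩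

noncomputable instance : OreLocalization.OreSet (⊤ : Submonoid (PosBraid n)) where
  ore_right_cancel _ _ c h := ⟨1, by rw [mul_right_cancel' _ h]⟩
  oreNum x y := (exists_mul_eq_mul x (y : PosBraid n)).choose_spec.choose
  oreDenom x y := ⟨(exists_mul_eq_mul x (y : PosBraid n)).choose, trivial⟩
  ore_eq x y := (exists_mul_eq_mul x (y : PosBraid n)).choose_spec.choose_spec

/-- The group of fractions of the positive braid monoid. -/
abbrev Frac (n : ℕ) := (OreLocalization (⊤ : Submonoid (PosBraid n)) (PosBraid n))ˣ

/-- The image of a positive braid in the group of fractions. -/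
noncomputable def toFrac (n : ℕ) : PosBraid n →* Frac n where
  toFun x := OreLocalization.numeratorUnit ⟨x, trivial⟩
  map_one' := Units.ext (map_one OreLocalization.numeratorHom)
  map_mul' x y := Units.ext (map_mul OreLocalization.numeratorHom x y)

theorem toFrac_injective : Function.Injective (toFrac n) := by
  intro x y h
  have h' := congrArg Units.val h
  obtain ⟨u, v, h1, h2⟩ := OreLocalization.oreDiv_eq_iff.1 h'
  simp only [OneMemClass.coe_one, mul_one] at h2
  subst h2
  exact (mul_left_cancel' _ h1).symm

/-- The natural map from the positive braid monoid to the braid group. -/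
def toBraid (n : ℕ) : PosBraid n →* Braid n :=
  PresentedMonoid.lift PresentedGroup.of (by
    intro a b h
    rw [← mul_inv_eq_one]
    cases h with
    | braid i j h => exact PresentedGroup.one_of_mem ⟨i, j, .inl ⟨h, rfl⟩⟩
    | comm i j h => exact PresentedGroup.one_of_mem ⟨i, j, .inr ⟨h, rfl⟩⟩)

/-- The natural map from the braid group to the group of fractions of the positive monoid. -/
noncomputable def ofBraid (n : ℕ) : Braid n →* Frac n :=
  PresentedGroup.toGroup (f := fun i => toFrac n (s i)) (by
    rintro r ⟨i, j, ⟨h, rfl⟩ | ⟨h, rfl⟩⟩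
    · simp only [map_mul, map_inv, FreeGroup.lift_apply_of]
      simp only [← map_mul]
      rw [s_braid (.inl h), mul_inv_cancel]
    · simp only [map_mul, map_inv, FreeGroup.lift_apply_of]
      simp only [← map_mul]
      rw [s_comm (.inl h), mul_inv_cancel])

theorem ofBraid_toBraid (x : PosBraid n) : ofBraid n (toBraid n x) = toFrac n x := by
  induction x using induction_on with
  | one => simp
  | gen i => exact PresentedGroup.toGroup.of _
  | mul x y hx hy => rw [map_mul, map_mul, hx, hy, map_mul]

theorem toBraid_injective : Function.Injective (toBraid n) := by
  intro x y h
  apply toFrac_injective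
  rw [← ofBraid_toBraid, h, ofBraid_toBraid]

theorem toBraid_s (i : Fin n) : toBraid n (s i) = gen n i := by
  simp only [gen, i.2, dif_pos]
  rfl

theorem mem_Mb_iff {x : Braid n} : x ∈ Mb n ↔ ∃ y, toBraid n y = x := by
  constructor
  · intro h
    induction h using Submonoid.closure_induction with
    | mem x hx =>
      obtain ⟨i, hi, rfl⟩ := hx
      exact ⟨s ⟨i, hi⟩, toBraid_s _⟩
    | one => exact ⟨1, map_one _⟩
    | mul x y _ _ hx hy =>
      obtain ⟨u, rfl⟩ := hx
      obtain ⟨v, rfl⟩ := hy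
      exact ⟨u * v, map_mul _ _ _⟩
  · rintro ⟨y, rfl⟩
    induction y using induction_on with
    | one => rw [map_one]; exact one_mem _
    | gen i => exact Submonoid.subset_closure ⟨i, i.2, toBraid_s i⟩
    | mul x y hx hy => rw [map_mul]; exact mul_mem hx hy

end PosBraid

/-! ### Divisibility in the braid group -/

section Parabolic

variable {n : ℕ}

theorem braidLike_gen (n : ℕ) : BraidLike n (gen n) := by
  have hs : ∀ i, i < n → PosBraid.toBraid n (PosBraid.sNat n i) = gen n i := fun i hi => by
    rw [← PosBraid.toBraid_s ⟨i, hi⟩, ← PosBraid.sNat_val]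
  constructor
  · intro i hi
    have := congrArg (PosBraid.toBraid n) ((PosBraid.braidLike_sNat n).braid i hi)
    simpa only [map_mul, hs i (by omega), hs (i + 1) hi] using this
  · intro i j hij hj
    have := congrArg (PosBraid.toBraid n) ((PosBraid.braidLike_sNat n).comm i j hij hj).eq
    rwa [map_mul, map_mul, hs i (by omega), hs j hj] at this

theorem gen_mem_Mb {i : ℕ} (hi : i < n) : gen n i ∈ Mb n :=
  Submonoid.subset_closure ⟨i, hi, rfl⟩

/-- The Garside lemma in the braid group. -/
theorem garside {x y : Braid n} (hx : x ∈ Mb n) (hy : y ∈ Mb n) {i j : ℕ} (hi : i < n)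
    (hj : j < n) (h : x * gen n i = y * gen n j) :
    (i = j ∧ x = y) ∨
    ((i + 2 ≤ j ∨ j + 2 ≤ i) ∧ ∃ z ∈ Mb n, x = z * gen n j ∧ y = z * gen n i) ∨
    ((i + 1 = j ∨ j + 1 = i) ∧
      ∃ z ∈ Mb n, x = z * gen n i * gen n j ∧ y = z * gen n j * gen n i) := by
  obtain ⟨x, rfl⟩ := PosBraid.mem_Mb_iff.1 hx
  obtain ⟨y, rfl⟩ := PosBraid.mem_Mb_iff.1 hy
  have hsi := PosBraid.toBraid_s (⟨i, hi⟩ : Fin n)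
  have hsj := PosBraid.toBraid_s (⟨j, hj⟩ : Fin n)
  dsimp only at hsi hsj
  rw [← hsi, ← hsj, ← map_mul, ← map_mul] at h
  rcases PosBraid.meets (PosBraid.toBraid_injective h) with
    ⟨hij, rfl⟩ | ⟨hij, z, rfl, rfl⟩ | ⟨hij, z, rfl, rfl⟩
  · exact .inl ⟨Fin.ext_iff.1 hij, rfl⟩
  · refine .inr (.inl ⟨hij, _, PosBraid.mem_Mb_iff.2 ⟨z, rfl⟩, ?_, ?_⟩) <;> simp [hsi, hsj]
  · refine .inr (.inr ⟨hij, _, PosBraid.mem_Mb_iff.2 ⟨z, rfl⟩, ?_, ?_⟩) <;> simp [hsi, hsj]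

/-- If `s_j` right-divides `x s_i` with `s_i` and `s_j` adjacent, then `s_i s_j` right-divides
`x`. -/
theorem mul_inv_inv_mem_of_adj {x : Braid n} (hx : x ∈ Mb n) {i j : ℕ} (hi : i < n) (hj : j < n)
    (hij : i + 1 = j ∨ j + 1 = i) (h : x * gen n i * (gen n j)⁻¹ ∈ Mb n) :
    x * (gen n j)⁻¹ * (gen n i)⁻¹ ∈ Mb n := by
  rcases garside hx h hi hj (by group) with ⟨h, -⟩ | ⟨h, -⟩ | ⟨-, z, hz, rfl, -⟩
  · omega
  · omega
  · simpa using hz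

/-- If `s_j` right-divides `x s_i` with `i ≠ j`, then `s_j` right-divides `x`. -/
theorem mul_inv_mem_of_ne {x : Braid n} (hx : x ∈ Mb n) {i j : ℕ} (hi : i < n) (hj : j < n)
    (hij : i ≠ j) (h : x * gen n i * (gen n j)⁻¹ ∈ Mb n) : x * (gen n j)⁻¹ ∈ Mb n := by
  rcases garside hx h hi hj (by group) with ⟨h, -⟩ | ⟨-, z, hz, rfl, -⟩ | ⟨-, z, hz, rfl, -⟩
  · exact absurd h hij
  · simpa using hz
  · simpa using mul_mem hz (gen_mem_Mb hi)

theorem list_prod_mem_Mb {l : List ℕ} (hl : ∀ i ∈ l, i < n) : (l.map (gen n)).prod ∈ Mb n := by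
  apply Submonoid.list_prod_mem
  intro x hx
  obtain ⟨i, hi, rfl⟩ := List.mem_map.1 hx
  exact gen_mem_Mb (hl i hi)

/-- If `s_j` right-divides `x w` for a positive word `w` without letter `s_j`, then `s_j`
right-divides `x`. -/
theorem mul_inv_mem_of_list {x : Braid n} (hx : x ∈ Mb n) {j : ℕ} (hj : j < n) {l : List ℕ}
    (hl : ∀ i ∈ l, i < n ∧ i ≠ j) (h : x * (l.map (gen n)).prod * (gen n j)⁻¹ ∈ Mb n) :
    x * (gen n j)⁻¹ ∈ Mb n := by
  induction l using List.reverseRecOn with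
  | nil => simpa using h
  | append_singleton l i ih =>
    have hi := hl i (by simp)
    have hl' : ∀ k ∈ l, k < n ∧ k ≠ j := fun k hk => hl k (by simp [hk])
    refine ih hl' (mul_inv_mem_of_ne (mul_mem hx (list_prod_mem_Mb fun k hk => (hl' k hk).1))
      hi.1 hj hi.2 ?_)
    simpa [mul_assoc] using h

/-- The degree homomorphism, sending each generator to `1`. -/
def degHom (n : ℕ) : Braid n →* Multiplicative ℤ :=
  PresentedGroup.toGroup (f := fun _ => Multiplicative.ofAdd 1) (by
    rintro r ⟨i, j, ⟨h, rfl⟩ | ⟨h, rfl⟩⟩ <;> simp)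

/-- The degree of a braid. -/
def deg (x : Braid n) : ℤ := (degHom n x).toAdd

@[simp] theorem deg_one : deg (1 : Braid n) = 0 := by simp [deg]

@[simp] theorem deg_mul (x y : Braid n) : deg (x * y) = deg x + deg y := by simp [deg]

@[simp] theorem deg_inv (x : Braid n) : deg x⁻¹ = -deg x := by simp [deg]

theorem deg_gen {i : ℕ} (hi : i < n) : deg (gen n i) = 1 := by
  simp [deg, gen, hi, degHom]

/-- The submonoid generated by the generators with index in `S`. -/
def par (n : ℕ) (S : Set ℕ) : Submonoid (Braid n) := Submonoid.closure (gen n '' S)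

theorem Mb_eq_par (n : ℕ) : Mb n = par n {i | i < n} := by
  refine congrArg Submonoid.closure ?_
  ext x
  simp [eq_comm]

theorem M₁b_eq_par (n : ℕ) : M₁b n = par n {i | 1 ≤ i ∧ i < n} := by
  refine congrArg Submonoid.closure ?_
  ext x
  simp [eq_comm, and_assoc]

theorem Nb_eq_par (n : ℕ) : Nb n = par n {i | i + 1 < n} := by
  refine congrArg Submonoid.closure ?_
  ext x
  simp [eq_comm]

theorem gen_mem_par {S : Set ℕ} {i : ℕ} (hi : i ∈ S) : gen n i ∈ par n S :=
  Submonoid.subset_closure ⟨i, hi, rfl⟩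

theorem list_prod_mem_par {S : Set ℕ} {l : List ℕ} (hl : ∀ i ∈ l, i ∈ S) :
    (l.map (gen n)).prod ∈ par n S := by
  apply Submonoid.list_prod_mem
  intro x hx
  obtain ⟨i, hi, rfl⟩ := List.mem_map.1 hx
  exact gen_mem_par (hl i hi)

theorem par_le_Mb {S : Set ℕ} (hS : ∀ i ∈ S, i < n) : par n S ≤ Mb n := by
  refine Submonoid.closure_le.2 ?_
  rintro _ ⟨i, hi, rfl⟩
  exact gen_mem_Mb (hS i hi)

theorem eq_one_or_of_mem_par {S : Set ℕ} {x : Braid n} (hx : x ∈ par n S) :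
    x = 1 ∨ ∃ y ∈ par n S, ∃ i ∈ S, x = y * gen n i := by
  induction hx using Submonoid.closure_induction_right with
  | one => exact .inl rfl
  | mul_right x hx y hy _ =>
    obtain ⟨i, hi, rfl⟩ := hy
    exact .inr ⟨x, hx, i, hi, rfl⟩

theorem deg_nonneg {x : Braid n} (hx : x ∈ Mb n) : 0 ≤ deg x := by
  induction hx using Submonoid.closure_induction with
  | mem x hx =>
    obtain ⟨i, hi, rfl⟩ := hx
    rw [deg_gen hi]
    exact zero_le_one
  | one => simp
  | mul x y _ _ hx hy => rw [deg_mul]; omega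

theorem eq_one_of_deg_nonpos {x : Braid n} (hx : x ∈ Mb n) (h : deg x ≤ 0) : x = 1 := by
  rw [Mb_eq_par] at hx
  rcases eq_one_or_of_mem_par hx with rfl | ⟨y, hy, i, hi, rfl⟩
  · rfl
  · rw [← Mb_eq_par] at hy
    have := deg_nonneg hy
    rw [deg_mul, deg_gen hi] at h
    omega

/-- Common left multiples of elements of a parabolic submonoid come from common left multiples
inside that submonoid. -/
theorem exists_common_multiple {S : Set ℕ} (hS : ∀ i ∈ S, i < n) (L : ℕ) :
    ∀ {x y b c : Braid n}, x ∈ Mb n → y ∈ Mb n → b ∈ par n S → c ∈ par n S →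
      deg (x * b) < L → x * b = y * c →
      ∃ z ∈ Mb n, ∃ u ∈ par n S, ∃ v ∈ par n S, x = z * u ∧ y = z * v ∧ u * b = v * c := by
  induction L with
  | zero =>
    intro x y b c hx hy hb hc hL _
    have := deg_nonneg (mul_mem hx (par_le_Mb hS hb))
    simp at hL this
    omega
  | succ L ih =>
    intro x y b c hx hy hb hc hL h
    rcases eq_one_or_of_mem_par hb with rfl | ⟨b, hb', i, hi, rfl⟩
    · exact ⟨y, hy, c, hc, 1, one_mem _, by simpa using h, by simp, by simp⟩
    rcases eq_one_or_of_mem_par hc with rfl | ⟨c, hc', j, hj, rfl⟩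
    · exact ⟨x, hx, 1, one_mem _, _, hb, by simp, by simpa using h.symm, by simp⟩
    have hxb := mul_mem hx (par_le_Mb hS hb')
    have hyc := mul_mem hy (par_le_Mb hS hc')
    have key : ∃ w ∈ Mb n, ∃ p ∈ par n S, ∃ q ∈ par n S, x * b = w * p ∧ y * c = w * q ∧
        p * gen n i = q * gen n j := by
      have hgi := gen_mem_par (n := n) hi
      have hgj := gen_mem_par (n := n) hj
      rcases garside hxb hyc (hS i hi) (hS j hj) (by simpa only [mul_assoc] using h) with
        ⟨rfl, he⟩ | ⟨hij, z, hz, h1, h2⟩ | ⟨hij, z, hz, h1, h2⟩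
      · exact ⟨_, hxb, 1, one_mem _, 1, one_mem _, by simp, by simp [he], rfl⟩
      · refine ⟨z, hz, _, hgj, _, hgi, h1, h2, ?_⟩
        rcases hij with hij | hij
        · exact ((braidLike_gen n).comm i j hij (hS j hj)).symm
        · exact (braidLike_gen n).comm j i hij (hS i hi)
      · refine ⟨z, hz, _, mul_mem hgi hgj, _, mul_mem hgj hgi, by rw [h1, mul_assoc],
          by rw [h2, mul_assoc], ?_⟩
        rcases hij with rfl | rfl
        · exact (braidLike_gen n).braid i (hS _ hj)
        · exact ((braidLike_gen n).braid j (hS _ hi)).symm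
    obtain ⟨w, hw, p, hp, q, hq, h1, h2, hpq⟩ := key
    have hdeg := congrArg deg h
    have hdeg1 := congrArg deg h1
    have hdegp := deg_nonneg (par_le_Mb hS hp)
    simp only [deg_mul, deg_gen (hS i hi), deg_gen (hS j hj)] at hdeg hdeg1 hL
    push_cast at hL
    obtain ⟨z₁, hz₁, u₁, hu₁, v₁, hv₁, rfl, hw₁, e₁⟩ :=
      ih hx hw hb' hp (by rw [deg_mul]; omega) h1
    obtain ⟨z₂, hz₂, u₂, hu₂, v₂, hv₂, rfl, hw₂, e₂⟩ :=
      ih hy hw hc' hq (by rw [deg_mul]; omega) h2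
    obtain ⟨z, hz, u, hu, v, hv, rfl, rfl, e⟩ :=
      ih hz₁ hz₂ hv₁ hv₂ (by rw [← hw₁]; omega) (hw₁.symm.trans hw₂)
    refine ⟨z, hz, u * u₁, mul_mem hu hu₁, v * u₂, mul_mem hv hu₂, mul_assoc _ _ _,
      mul_assoc _ _ _, ?_⟩
    calc u * u₁ * (b * gen n i) = u * (u₁ * b) * gen n i := by simp only [mul_assoc]
      _ = u * v₁ * (p * gen n i) := by rw [e₁]; simp only [mul_assoc]
      _ = v * (v₂ * q) * gen n j := by rw [e, hpq]; simp only [mul_assoc]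
      _ = v * u₂ * (c * gen n j) := by rw [← e₂]; simp only [mul_assoc]

/-- No generator with index in `S` right-divides `x`. -/
def Coprime (S : Set ℕ) (x : Braid n) : Prop := ∀ i ∈ S, x * (gen n i)⁻¹ ∉ Mb n

theorem coprime_one {S : Set ℕ} (hS : ∀ i ∈ S, i < n) : Coprime S (1 : Braid n) := by
  intro i hi h
  have := deg_nonneg h
  rw [one_mul, deg_inv, deg_gen (hS i hi)] at this
  omega

theorem exists_coprime_mul {S : Set ℕ} (hS : ∀ i ∈ S, i < n) (L : ℕ) :
    ∀ {x : Braid n}, x ∈ Mb n → deg x < L →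
      ∃ x' ∈ Mb n, Coprime S x' ∧ ∃ y ∈ par n S, x = x' * y := by
  induction L with
  | zero =>
    intro x hx hL
    have := deg_nonneg hx
    simp at hL
    omega
  | succ L ih =>
    intro x hx hL
    by_cases hc : Coprime S x
    · exact ⟨x, hx, hc, 1, one_mem _, by simp⟩
    · simp only [Coprime, not_forall, not_not] at hc
      obtain ⟨i, hi, hxi⟩ := hc
      obtain ⟨x', hx', hc', y, hy, e⟩ := ih hxi (by
        rw [deg_mul, deg_inv, deg_gen (hS i hi)]
        push_cast at hL
        omega)
      exact ⟨x', hx', hc', y * gen n i, mul_mem hy (gen_mem_par hi), by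
        rw [← mul_assoc, ← e, inv_mul_cancel_right]⟩

theorem tail_mul {S : Set ℕ} (hS : ∀ i ∈ S, i < n) {x y : Braid n} (hx : x ∈ Mb n)
    (hc : Coprime S x) (hy : y ∈ par n S) : tail (Mb n) (par n S) (x * y) = y := by
  have key : ∀ c ∈ par n S, (leR (Mb n) c (x * y) ↔ leR (Mb n) c y) := by
    intro c hcS
    refine ⟨fun h => ?_, fun h => ?_⟩
    · obtain ⟨z, hz, u, hu, v, hv, rfl, -, e⟩ :=
        exists_common_multiple hS ((deg (x * y)).toNat + 1) hx h hy hcS (by omega)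
          (by group)
      rcases eq_one_or_of_mem_par hu with rfl | ⟨u, hu', i, hi, rfl⟩
      · rw [one_mul] at e
        rw [leR, e, mul_inv_cancel_right]
        exact par_le_Mb hS hv
      · refine absurd ?_ (hc i hi)
        rw [← mul_assoc, mul_inv_cancel_right]
        exact mul_mem hz (par_le_Mb hS hu')
    · rw [leR, mul_assoc]
      exact mul_mem hx h
  have hex : ∃ b : Braid n, b ∈ par n S ∧
      {c | c ∈ par n S ∧ leR (Mb n) c (x * y)} = {c | c ∈ par n S ∧ leR (Mb n) c b} :=
    ⟨y, hy, Set.ext fun c => and_congr_right (key c)⟩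
  have hrefl : ∀ a : Braid n, leR (Mb n) a a := fun a => by
    rw [leR, mul_inv_cancel]
    exact one_mem _
  rw [tail, dif_pos hex]
  obtain ⟨hb, he⟩ := hex.choose_spec
  set b := hex.choose
  have h1 : leR (Mb n) b y := (key b hb).1 (he.symm.subset ⟨hb, hrefl b⟩).2
  have h2 : leR (Mb n) y b := (he.subset ⟨hy, (key y hy).2 (hrefl y)⟩).2
  have hd := deg_nonneg h2
  rw [deg_mul, deg_inv] at hd
  have := eq_one_of_deg_nonpos h1 (by rw [deg_mul, deg_inv]; omega)
  exact (mul_inv_eq_one.1 this).symm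

end Parabolic

/-! ### Multiplication by `θ` -/

section Theta

variable {n : ℕ}

theorem thetaWordb_eq (n : ℕ) : thetaWordb n = up (gen n) n * down (gen n) n := by
  simp [thetaWordb, seg, segRev, up, down]

theorem up_mem_Mb {m : ℕ} (hm : m ≤ n) : up (gen n) m ∈ Mb n :=
  list_prod_mem_Mb fun i hi => by simp at hi; omega

theorem down_mem_Mb {m : ℕ} (hm : m ≤ n) : down (gen n) m ∈ Mb n :=
  list_prod_mem_Mb fun i hi => by simp at hi; omega

theorem range_eq_append {i : ℕ} (hi : i + 1 < n) :
    List.range n = List.range i ++ i :: (i + 1) :: List.range' (i + 2) (n - (i + 2)) := by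
  conv_lhs => rw [show n = i + (n - (i + 2) + 1 + 1) by omega]
  rw [List.range_eq_range', List.range_eq_range', ← List.range'_append_1, Nat.zero_add,
    List.range'_succ, List.range'_succ]

theorem coprime_mul_up {b : Braid n} (hb : b ∈ Mb n) (hc : Coprime {i | 1 ≤ i ∧ i < n} b) :
    Coprime {i | i + 1 < n} (b * up (gen n) n) := by
  intro i (hi : i + 1 < n) h
  have hbi := mul_mem hb (up_mem_Mb (n := n) (m := i) (by omega))
  refine hc (i + 1) ⟨by omega, hi⟩ ?_
  have h1 : b * up (gen n) i * gen n i * gen n (i + 1) * (gen n i)⁻¹ ∈ Mb n := by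
    refine mul_inv_mem_of_list (l := List.range' (i + 2) (n - (i + 2)))
      (mul_mem (mul_mem hbi (gen_mem_Mb (by omega))) (gen_mem_Mb hi)) (by omega) ?_ ?_
    · intro k hk
      simp [List.mem_range'_1] at hk
      omega
    · rw [up, range_eq_append hi] at h
      simpa [up, mul_assoc] using h
  have h2 := mul_inv_inv_mem_of_adj (mul_mem hbi (gen_mem_Mb (by omega))) hi (by omega)
    (.inr rfl) h1
  rw [mul_inv_cancel_right] at h2
  refine mul_inv_mem_of_list hb hi (l := List.range i) ?_ h2
  intro k hk
  simp at hk
  omega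

theorem coprime_mul_thetaWordb {b : Braid n} (hb : b ∈ Mb n)
    (hc : Coprime {i | 1 ≤ i ∧ i < n} b) :
    Coprime {i | 1 ≤ i ∧ i < n} (b * thetaWordb n) := by
  rintro j ⟨hj, hjn⟩ h
  obtain ⟨i, rfl⟩ : ∃ i, j = i + 1 := ⟨j - 1, by omega⟩
  have hbu := mul_mem hb (up_mem_Mb (le_refl n))
  refine coprime_mul_up hb hc i hjn ?_
  set w := ((List.range' (i + 2) (n - (i + 2))).reverse.map (gen n)).prod with hw
  have hbw : b * up (gen n) n * w ∈ Mb n := by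
    refine mul_mem hbu (list_prod_mem_Mb fun k hk => ?_)
    simp [List.mem_range'_1] at hk
    omega
  have h1 : b * up (gen n) n * w * gen n (i + 1) * gen n i * (gen n (i + 1))⁻¹ ∈ Mb n := by
    refine mul_inv_mem_of_list (l := (List.range i).reverse)
      (mul_mem (mul_mem hbw (gen_mem_Mb hjn)) (gen_mem_Mb (by omega))) hjn ?_ ?_
    · intro k hk
      simp at hk
      omega
    · rw [thetaWordb_eq, down, range_eq_append hjn] at h
      simpa [hw, mul_assoc] using h
  have h2 := mul_inv_inv_mem_of_adj (mul_mem hbw (gen_mem_Mb hjn)) (by omega) hjn (.inl rfl) h1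
  rw [mul_inv_cancel_right] at h2
  refine mul_inv_mem_of_list hbu (by omega) ?_ h2
  intro k hk
  simp [List.mem_range'_1] at hk
  omega

theorem commute_thetaWordb {y : Braid n} (hy : y ∈ M₁b n) : Commute (thetaWordb n) y := by
  rw [thetaWordb_eq]
  induction hy using Submonoid.closure_induction with
  | mem x hx =>
    obtain ⟨i, hi, hin, rfl⟩ := hx
    exact (braidLike_gen n).commute_up_mul_down hi hin
  | one => exact Commute.one_right _
  | mul x y _ _ hx hy => exact hx.mul_right hy

theorem thetaWordb_mem_Mb (n : ℕ) : thetaWordb n ∈ Mb n := by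
  rw [thetaWordb_eq]
  exact mul_mem (up_mem_Mb le_rfl) (down_mem_Mb le_rfl)

/-! ### Alternating forms -/

/-- The step of `strip` at an even index. -/
theorem strip_succ_of_even {i : ℕ} (hi : i % 2 = 0) {a x y : Braid n} (hx : x ∈ Mb n)
    (hc : Coprime {i | 1 ≤ i ∧ i < n} x) (hy : y ∈ M₁b n)
    (h : strip (Mb n) (M₁b n) (Nb n) i a = x * y) :
    strip (Mb n) (M₁b n) (Nb n) (i + 1) a = x := by
  rw [strip, h, if_pos hi]
  rw [M₁b_eq_par] at hy ⊢
  rw [tail_mul (fun k hk => hk.2) hx hc hy, mul_inv_cancel_right]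

/-- The step of `strip` at an odd index. -/
theorem strip_succ_of_odd {i : ℕ} (hi : i % 2 = 1) {a x y : Braid n} (hx : x ∈ Mb n)
    (hc : Coprime {i | i + 1 < n} x) (hy : y ∈ Nb n)
    (h : strip (Mb n) (M₁b n) (Nb n) i a = x * y) :
    strip (Mb n) (M₁b n) (Nb n) (i + 1) a = x := by
  rw [strip, h, if_neg (by omega)]
  rw [Nb_eq_par] at hy ⊢
  rw [tail_mul (S := {i | i + 1 < n}) (fun k (hk : k + 1 < n) => by omega) hx hc hy,
    mul_inv_cancel_right]

theorem strip_succ_eq_one {i : ℕ} {a : Braid n} (h : strip (Mb n) (M₁b n) (Nb n) i a = 1) :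
    strip (Mb n) (M₁b n) (Nb n) (i + 1) a = 1 := by
  rcases Nat.mod_two_eq_zero_or_one i with hi | hi
  · exact strip_succ_of_even hi (one_mem _) (coprime_one fun k hk => hk.2) (one_mem _)
      (by rw [h, mul_one])
  · exact strip_succ_of_odd hi (one_mem _)
      (coprime_one fun k (hk : k + 1 < n) => by omega) (one_mem _) (by rw [h, mul_one])

theorem strip_add_two {G : Type*} [Group G] (M M₁ N : Submonoid G) (i : ℕ) (a : G) :
    strip M M₁ N (i + 2) a = strip M M₁ N i (strip M M₁ N 2 a) := by
  induction i with
  | zero => rfl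
  | succ i ih =>
    rw [show i + 1 + 2 = (i + 2) + 1 by omega, strip, ih, Nat.add_mod_right]
    rfl

/-- The last two factors of the alternating form. -/
theorem exists_strip_two {a : Braid n} (ha : a ∈ Mb n) :
    ∃ b ∈ Mb n, Coprime {i | 1 ≤ i ∧ i < n} b ∧ ∃ a₁ ∈ M₁b n, a = b * a₁ ∧
      ∃ c ∈ Mb n, Coprime {i | i + 1 < n} c ∧ ∃ a₂ ∈ Nb n, b = c * a₂ ∧
        strip (Mb n) (M₁b n) (Nb n) 1 a = b ∧ strip (Mb n) (M₁b n) (Nb n) 2 a = c := by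
  have key : ∀ {S : Set ℕ}, (∀ i ∈ S, i < n) → ∀ {x : Braid n}, x ∈ Mb n →
      ∃ x' ∈ Mb n, Coprime S x' ∧ ∃ y ∈ par n S, x = x' * y := fun hS x hx =>
    exists_coprime_mul hS ((deg x).toNat + 1) hx (by omega)
  obtain ⟨b, hb, hbc, a₁, ha₁, e₁⟩ := key (S := {i | 1 ≤ i ∧ i < n}) (fun k hk => hk.2) ha
  obtain ⟨c, hc, hcc, a₂, ha₂, e₂⟩ :=
    key (S := {i | i + 1 < n}) (fun k (hk : k + 1 < n) => by omega) hb
  rw [← M₁b_eq_par] at ha₁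
  rw [← Nb_eq_par] at ha₂
  have h1 : strip (Mb n) (M₁b n) (Nb n) 1 a = b := strip_succ_of_even rfl hb hbc ha₁ e₁
  exact ⟨b, hb, hbc, a₁, ha₁, e₁, c, hc, hcc, a₂, ha₂, e₂, h1,
    strip_succ_of_odd rfl hc hcc ha₂ (h1.trans e₂)⟩

theorem M₁b_le_Mb (n : ℕ) : M₁b n ≤ Mb n := by
  rw [M₁b_eq_par]
  exact par_le_Mb fun i hi => hi.2

theorem Nb_le_Mb (n : ℕ) : Nb n ≤ Mb n := by
  rw [Nb_eq_par]
  exact par_le_Mb fun i (hi : i + 1 < n) => by omega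

/-- Stripping alternating tails terminates. -/
theorem exists_strip_eq_one (hn : 2 ≤ n) (L : ℕ) : ∀ {a : Braid n}, a ∈ Mb n → deg a < L →
    ∃ p, 1 ≤ p ∧ strip (Mb n) (M₁b n) (Nb n) p a = 1 := by
  induction L with
  | zero =>
    intro a ha hL
    have := deg_nonneg ha
    simp at hL
    omega
  | succ L ih =>
    intro a ha hL
    by_cases h1 : a = 1
    · exact ⟨1, le_rfl, strip_succ_eq_one h1⟩
    obtain ⟨b, hb, hbc, a₁, ha₁, e₁, c, hc, hcc, a₂, ha₂, e₂, -, hs⟩ := exists_strip_two ha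
    have hlt : deg c < deg a := by
      by_contra hge
      have hd₁ := deg_nonneg (M₁b_le_Mb n ha₁)
      have hd₂ := deg_nonneg (Nb_le_Mb n ha₂)
      have hd := congrArg deg e₁
      have hd' := congrArg deg e₂
      rw [deg_mul] at hd hd'
      obtain rfl := eq_one_of_deg_nonpos (M₁b_le_Mb n ha₁) (by omega)
      obtain rfl := eq_one_of_deg_nonpos (Nb_le_Mb n ha₂) (by omega)
      rw [mul_one] at e₁ e₂
      subst e₁ e₂
      have ha' := ha
      rw [Mb_eq_par] at ha'
      rcases eq_one_or_of_mem_par ha' with h | ⟨y, hy, i, hi, rfl⟩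
      · exact h1 h
      · rw [← Mb_eq_par] at hy
        have hi' : i < n := hi
        rcases Nat.eq_zero_or_pos i with rfl | hi0
        · exact hcc 0 (by simp; omega) (by rwa [mul_inv_cancel_right])
        · exact hbc i ⟨hi0, hi'⟩ (by rwa [mul_inv_cancel_right])
    obtain ⟨p, hp, hp'⟩ := ih hc (by push_cast at hL; omega)
    exact ⟨p + 2, by omega, by rw [strip_add_two, hs, hp']⟩

theorem mem_M₁b_iff_strip_eq_one {a : Braid n} (ha : a ∈ Mb n) :
    a ∈ M₁b n ↔ strip (Mb n) (M₁b n) (Nb n) 1 a = 1 := by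
  refine ⟨fun h => strip_succ_of_even rfl (one_mem _) (coprime_one fun k hk => hk.2) h
    (one_mul a).symm, fun h => ?_⟩
  obtain ⟨b, -, -, a₁, ha₁, e₁, -, -, -, -, -, -, hs, -⟩ := exists_strip_two ha
  rw [h] at hs
  rwa [e₁, ← hs, one_mul]

/-- The first four steps of stripping alternating tails from `a θ`. -/
theorem strip_mul_thetaWordb (hn : 2 ≤ n) {a : Braid n} (ha : a ∈ Mb n) :
    strip (Mb n) (M₁b n) (Nb n) 3 (a * thetaWordb n) ≠ 1 ∧
      strip (Mb n) (M₁b n) (Nb n) 4 (a * thetaWordb n) = strip (Mb n) (M₁b n) (Nb n) 2 a := by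
  obtain ⟨b, hb, hbc, a₁, ha₁, rfl, c, hc, hcc, a₂, ha₂, e₂, -, hs⟩ := exists_strip_two ha
  obtain ⟨m, rfl⟩ : ∃ m, n = m + 1 := ⟨n - 1, by omega⟩
  have hlast : gen (m + 1) m ∈ M₁b (m + 1) := Submonoid.subset_closure ⟨m, by omega, by omega, rfl⟩
  have hfirst : gen (m + 1) 0 ∈ Nb (m + 1) := Submonoid.subset_closure ⟨0, by omega, rfl⟩
  have hb0 : b * gen (m + 1) 0 ∈ Mb (m + 1) := mul_mem hb (gen_mem_Mb (by omega))
  have s1 : strip (Mb (m + 1)) (M₁b (m + 1)) (Nb (m + 1)) 1 (b * a₁ * thetaWordb (m + 1)) =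
      b * thetaWordb (m + 1) := by
    refine strip_succ_of_even rfl (mul_mem hb (thetaWordb_mem_Mb _))
      (coprime_mul_thetaWordb hb hbc) ha₁ ?_
    rw [strip, mul_assoc, ← (commute_thetaWordb ha₁).eq, mul_assoc]
  have s2 : strip (Mb (m + 1)) (M₁b (m + 1)) (Nb (m + 1)) 2 (b * a₁ * thetaWordb (m + 1)) =
      b * up (gen (m + 1)) (m + 1) * gen (m + 1) m := by
    have hup := mul_mem hb (up_mem_Mb (le_refl (m + 1)))
    refine strip_succ_of_odd rfl (mul_mem hup (M₁b_le_Mb _ hlast)) ?_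
      (y := down (gen (m + 1)) m) ?_ ?_
    · intro i (hi : i + 1 < m + 1) h
      exact coprime_mul_up hb hbc i hi
        (mul_inv_mem_of_ne hup (by omega) (by omega) (by omega) h)
    · rw [Nb_eq_par]
      exact list_prod_mem_par fun i hi => by simp at hi ⊢; omega
    · rw [s1, thetaWordb_eq, down_succ]
      simp only [mul_assoc]
  have s3 : strip (Mb (m + 1)) (M₁b (m + 1)) (Nb (m + 1)) 3 (b * a₁ * thetaWordb (m + 1)) =
      b * gen (m + 1) 0 := by
    refine strip_succ_of_even rfl hb0 ?_
      (y := up (fun i => gen (m + 1) (i + 1)) m * gen (m + 1) m) (mul_mem ?_ hlast) ?_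
    · rintro i ⟨hi, hin⟩ h
      exact hbc i ⟨hi, hin⟩ (mul_inv_mem_of_ne hb (by omega) hin (by omega) h)
    · refine Submonoid.list_prod_mem _ fun x hx => ?_
      obtain ⟨i, hi, rfl⟩ := List.mem_map.1 hx
      exact Submonoid.subset_closure ⟨i + 1, by omega, by simp at hi; omega, rfl⟩
    · rw [s2, up_succ']
      simp only [mul_assoc]
  refine ⟨fun h => ?_, ?_⟩
  · have hd := congrArg deg (s3.symm.trans h)
    have hd' := deg_nonneg hb
    rw [deg_mul, deg_gen (by omega), deg_one] at hd
    omega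
  · rw [hs]
    exact strip_succ_of_odd rfl hc hcc (mul_mem ha₂ hfirst) (by rw [s3, e₂, mul_assoc])

/-- Right multiplication by `θ` increases the breadth by `2` outside `M₁`. -/
theorem bh_mul_thetaWordb (hn : 2 ≤ n) {a : Braid n} (ha : a ∈ Mb n) (ha₁ : a ∉ M₁b n) :
    bh (Mb n) (M₁b n) (Nb n) (a * thetaWordb n) = bh (Mb n) (M₁b n) (Nb n) a + 2 := by
  obtain ⟨h3, h4⟩ := strip_mul_thetaWordb hn ha
  have h2 := mt strip_succ_eq_one h3
  have h1 := mt strip_succ_eq_one h2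
  have h0 := mt (mem_M₁b_iff_strip_eq_one ha).2 ha₁
  have hadd : ∀ p, strip (Mb n) (M₁b n) (Nb n) (p + 4) (a * thetaWordb n) =
      strip (Mb n) (M₁b n) (Nb n) (p + 2) a := fun p => by
    rw [show p + 4 = p + 2 + 2 by omega, strip_add_two, strip_add_two, strip_add_two _ _ _ p a,
      ← h4, ← strip_add_two _ _ _ 2]
  have hne : ∀ {x : Braid n}, x ∈ Mb n →
      {p | 1 ≤ p ∧ strip (Mb n) (M₁b n) (Nb n) p x = 1}.Nonempty := fun {x} hx =>
    exists_strip_eq_one hn ((deg x).toNat + 1) hx (by omega)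
  obtain ⟨hp, hp'⟩ := Nat.sInf_mem (hne ha)
  obtain ⟨hq, hq'⟩ := Nat.sInf_mem (hne (mul_mem ha (thetaWordb_mem_Mb n)))
  change 1 ≤ bh (Mb n) (M₁b n) (Nb n) a at hp
  change strip _ _ _ (bh (Mb n) (M₁b n) (Nb n) a) _ = 1 at hp'
  change 1 ≤ bh (Mb n) (M₁b n) (Nb n) (a * thetaWordb n) at hq
  change strip _ _ _ (bh (Mb n) (M₁b n) (Nb n) (a * thetaWordb n)) _ = 1 at hq'
  apply le_antisymm
  · refine Nat.sInf_le ⟨by omega, ?_⟩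
    generalize bh (Mb n) (M₁b n) (Nb n) a = p at hp hp'
    obtain ⟨p, rfl⟩ : ∃ r, p = r + 2 :=
      ⟨p - 2, by have : p ≠ 1 := (fun h => h0 (h ▸ hp')); omega⟩
    rw [← hp', ← hadd]
  · generalize bh (Mb n) (M₁b n) (Nb n) (a * thetaWordb n) = q at hq hq'
    obtain ⟨q, rfl⟩ : ∃ r, q = r + 4 := ⟨q - 4, by
      have k1 : q ≠ 1 := fun h => h1 (h ▸ hq')
      have k2 : q ≠ 2 := fun h => h2 (h ▸ hq')
      have k3 : q ≠ 3 := fun h => h3 (h ▸ hq')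
      omega⟩
    have : bh (Mb n) (M₁b n) (Nb n) a ≤ q + 2 := Nat.sInf_le ⟨by omega, by rw [← hadd, hq']⟩
    omega

theorem mul_thetaWordb_notMem (hn : 2 ≤ n) {a : Braid n} (ha : a ∈ Mb n) :
    a * thetaWordb n ∉ M₁b n := by
  rw [mem_M₁b_iff_strip_eq_one (mul_mem ha (thetaWordb_mem_Mb n))]
  exact mt strip_succ_eq_one (mt strip_succ_eq_one (strip_mul_thetaWordb hn ha).1)

end Theta

end BraidOrder

open GarsideOrder BraidOrder in
/-- For every `a ∈ M \ M₁` and every `k ≥ 1`, `dpt (a θ^k) = dpt a + k`. -/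
theorem statement14 (n : ℕ) (hn : 2 ≤ n) :
    ∀ a ∈ Mb n, a ∉ M₁b n → ∀ k : ℕ, 1 ≤ k →
      dpt (Mb n) (M₁b n) (Nb n) (a * thetaWordb n ^ k) =
        dpt (Mb n) (M₁b n) (Nb n) a + k := by
  intro a ha ha₁ k _
  clear * - hn ha ha₁
  induction k generalizing a with
  | zero => simp
  | succ k ih =>
    rw [pow_succ', ← mul_assoc, ih _ (mul_mem ha (thetaWordb_mem_Mb n))
      (mul_thetaWordb_notMem hn ha), dpt, dpt, bh_mul_thetaWordb hn ha ha₁]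
    omega
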